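/- Let n be odd, L(x) = a·x^{2^k} + b·x^{2^l} be nonzero with a, b ∈ F_{q^n}, and k, l integers with 0 ≤ k, l < mn, k ≢ l (mod m) and l ≡ 1 (mod m). Set d = gcd(l-k, mn) and s = gcd(k-1, m). Then Tr(x^{q+1}) + L(x) is a permutation polynomial of F_{q^n} if and only if a, b ∈ F_q, a^{(q-1)/(2^s-1)} ≠ (b+1)^{(q-1)/(2^s-1)}, and either a^{(q^n-1)/(2^d-1)} ≠ b^{(q^n-1)/(2^d-1)}, or d divides m and a^{(q-1)/(2^d-1)} = b^{(q-1)/(2^d-1)}. In particular, when b = 0, Tr(x^{q+1}) + a·x^{2^k} is a permutation polynomial of F_{q^n} if and only if a ∈ F_q^* and a^{(q-1)/(2^s-1)} ≠ 1. -/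

import Mathlib

theorem IsCyclic.exists_pow_eq_one_and_pow_eq_iff {G : Type*} [CommGroup G] [Finite G] [IsCyclic G]
    {Q : ℕ} (hQ : Q ∣ Nat.card G) (r : ℕ) (c : G) :
    (∃ z : G, z ^ Q = 1 ∧ z ^ r = c) ↔ c ^ (Q / r.gcd Q) = 1 := by
  have hQ0 : 0 < Q := Nat.pos_of_dvd_of_pos hQ Nat.card_pos
  have hg0 : 0 < r.gcd Q := Nat.gcd_pos_of_pos_right r hQ0
  constructor
  · rintro ⟨z, hz, rfl⟩
    obtain ⟨u, hu⟩ := Nat.gcd_dvd_left r Q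
    rw [← pow_mul]
    nth_rw 1 [hu]
    rw [mul_assoc, mul_comm, mul_assoc, Nat.div_mul_cancel (Nat.gcd_dvd_right r Q), mul_comm,
      pow_mul, hz, one_pow]
  · intro h
    obtain ⟨ζ, hgen⟩ := IsCyclic.exists_monoid_generator (α := G)
    have hζ := orderOf_eq_card_of_forall_mem_powers hgen
    obtain ⟨t, rfl⟩ := Submonoid.mem_powers_iff _ _ |>.mp (hgen c)
    obtain ⟨w, hw⟩ := hQ
    have hdvd : r.gcd Q * w ∣ t := by
      rw [← pow_mul] at h
      have h1 := orderOf_dvd_of_pow_eq_one h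
      rw [hζ, hw] at h1
      have hpos : 0 < Q / r.gcd Q := Nat.div_pos (Nat.le_of_dvd hQ0 (Nat.gcd_dvd_right r Q)) hg0
      refine Nat.dvd_of_mul_dvd_mul_right hpos ?_
      rwa [mul_right_comm, Nat.mul_div_cancel' (Nat.gcd_dvd_right r Q)]
    obtain ⟨u, rfl⟩ := hdvd
    have hN : ζ ^ (Q * w) = 1 := by rw [← hw, ← hζ, pow_orderOf_eq_one]
    have hNz : ζ ^ ((Q : ℤ) * w) = 1 := by exact_mod_cast hN
    refine ⟨ζ ^ ((w : ℤ) * u * r.gcdA Q), ?_, ?_⟩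
    · rw [← zpow_natCast, ← zpow_mul,
        show (w : ℤ) * u * r.gcdA Q * (Q : ℤ) = (Q * w) * (u * r.gcdA Q) by ring, zpow_mul, hNz,
        one_zpow]
    · rw [← zpow_natCast, ← zpow_mul, ← zpow_natCast]
      push_cast
      rw [Nat.gcd_eq_gcd_ab, show ((r : ℤ) * r.gcdA Q + Q * r.gcdB Q) * w * u
        = (w * u * r.gcdA Q) * r + (Q * w) * (u * r.gcdB Q) by ring, zpow_add, zpow_mul ζ (Q * w),
        hNz, one_zpow, mul_one]

theorem pow_two_pow_gcd_eq_self {R : Type*} [CommRing R] [CharP R 2] {t : R} {i j : ℕ}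
    (hi : t ^ 2 ^ i = t) (hj : t ^ 2 ^ j = t) : t ^ 2 ^ i.gcd j = t := by
  rw [← iterate_frobenius] at *
  exact Function.IsPeriodicPt.gcd hi hj

theorem pow_two_pow_eq_self_of_dvd {R : Type*} [CommRing R] [CharP R 2] {t : R} {i j : ℕ}
    (hi : t ^ 2 ^ i = t) (hij : i ∣ j) : t ^ 2 ^ j = t := by
  rw [← iterate_frobenius] at *
  exact Function.IsPeriodicPt.trans_dvd hi hij

theorem two_pow_sub_one_div_ne_zero {e m : ℕ} (hm : 0 < m) (he : e ∣ m) :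
    (2 ^ m - 1) / (2 ^ e - 1) ≠ 0 := by
  have he0 := Nat.pos_of_dvd_of_pos he hm
  have h1 : 1 < 2 ^ e := Nat.one_lt_two_pow he0.ne'
  have h2 : 2 ^ e ≤ 2 ^ m := Nat.pow_le_pow_right two_pos (Nat.le_of_dvd hm he)
  exact (Nat.div_pos (by omega) (by omega)).ne'

theorem AddMonoidHom.ker_comp_eq_of_le {G : Type*} [AddGroup G] [Finite G] (f g : G →+ G)
    (h : (f.comp g).ker ≤ f.ker) : (f.comp g).ker = f.ker := by
  refine AddSubgroup.eq_of_le_of_card_ge h ?_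
  have h1 := (f.comp g).ker.index_mul_card
  have h2 := f.ker.index_mul_card
  rw [AddSubgroup.index_ker] at h1 h2
  have h3 : Nat.card (f.comp g).range ≤ Nat.card f.range := by
    refine Nat.card_mono (Set.toFinite _) ?_
    rintro _ ⟨x, rfl⟩
    exact ⟨g x, rfl⟩
  refine Nat.le_of_mul_le_mul_left (c := Nat.card f.range) ?_ Nat.card_pos
  rw [h2, ← h1]
  exact Nat.mul_le_mul_right _ h3

section FiniteField

variable {F : Type*} [Field F]

theorem pow_two_pow_sub_one_eq_one_iff {z : F} (hz : z ≠ 0) (m : ℕ) :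
    z ^ (2 ^ m - 1) = 1 ↔ z ^ 2 ^ m = z := by
  rw [← mul_left_inj' hz, ← pow_succ, Nat.sub_add_cancel Nat.one_le_two_pow, one_mul]

theorem pow_two_pow_injective [CharP F 2] (i : ℕ) : Function.Injective fun x : F => x ^ 2 ^ i :=
  iterateFrobenius_inj F 2 i

theorem pow_two_pow_surjective [CharP F 2] [Finite F] (i : ℕ) :
    Function.Surjective fun x : F => x ^ 2 ^ i :=
  Finite.surjective_of_injective (pow_two_pow_injective i)

theorem exists_mul_pow_eq_mul_pow_iff_of_le [CharP F 2] [Finite F] {M m : ℕ}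
    (hF : Nat.card F = 2 ^ M) (hm : 0 < m) (hmM : m ∣ M) (a b : F) {i j : ℕ} (hij : i ≤ j) :
    (∃ z : F, z ≠ 0 ∧ z ^ 2 ^ m = z ∧ a * z ^ 2 ^ i = b * z ^ 2 ^ j) ↔
      a ^ ((2 ^ m - 1) / (2 ^ (j - i).gcd m - 1)) =
        b ^ ((2 ^ m - 1) / (2 ^ (j - i).gcd m - 1)) := by
  have hE := two_pow_sub_one_div_ne_zero hm (Nat.gcd_dvd_right (j - i) m)
  rcases eq_or_ne b 0 with rfl | hb
  · rw [zero_pow hE, pow_eq_zero_iff hE]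
    constructor
    · rintro ⟨z, hz, -, h⟩
      simpa [hz] using h
    · rintro rfl
      exact ⟨1, by simp⟩
  rcases eq_or_ne a 0 with rfl | ha
  · rw [zero_pow hE, eq_comm, pow_eq_zero_iff hE]
    constructor
    · rintro ⟨z, hz, -, h⟩
      simpa [hz] using h.symm
    · exact fun h => absurd h hb
  have hQ : 2 ^ m - 1 ∣ Nat.card Fˣ := by
    rw [Nat.card_units, hF]
    exact Nat.pow_sub_one_dvd_pow_sub_one 2 hmM
  have key := IsCyclic.exists_pow_eq_one_and_pow_eq_iff hQ (2 ^ (j - i) - 1)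
    (Units.mk0 a ha / Units.mk0 b hb)
  rw [Nat.pow_sub_one_gcd_pow_sub_one, div_pow, div_eq_one] at key
  have hval : ∀ N, Units.mk0 a ha ^ N = Units.mk0 b hb ^ N ↔ a ^ N = b ^ N := by
    simp [Units.ext_iff]
  rw [← hval, ← key]
  have hsplit : ∀ z : F, z ^ 2 ^ j = (z ^ 2 ^ i) ^ (2 ^ (j - i) - 1) * z ^ 2 ^ i := by
    intro z
    rw [← pow_succ, Nat.sub_add_cancel Nat.one_le_two_pow, ← pow_mul, ← pow_add,
      Nat.add_sub_cancel' hij]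
  constructor
  · rintro ⟨z, hz, hzm, h⟩
    have hz' : z ^ 2 ^ i ≠ 0 := pow_ne_zero _ hz
    refine ⟨Units.mk0 _ hz', ?_, ?_⟩
    · rw [Units.ext_iff]
      have := (pow_two_pow_sub_one_eq_one_iff hz m).mpr hzm
      simp only [Units.val_pow_eq_pow_val, Units.val_mk0, Units.val_one]
      rw [pow_right_comm, this, one_pow]
    · rw [eq_div_iff_mul_eq', Units.ext_iff]
      simp only [Units.val_pow_eq_pow_val, Units.val_mk0, Units.val_mul]
      rw [hsplit, ← mul_assoc] at h
      rw [mul_right_cancel₀ hz' h, mul_comm]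
  · rintro ⟨u, hu, hc⟩
    obtain ⟨z, hz⟩ := pow_two_pow_surjective i (u : F)
    simp only at hz
    have hz0 : z ≠ 0 := by
      rintro rfl
      simp at hz
      exact u.ne_zero hz.symm
    refine ⟨z, hz0, ?_, ?_⟩
    · apply pow_two_pow_injective i
      simp only
      rw [pow_right_comm, hz, ← pow_two_pow_sub_one_eq_one_iff u.ne_zero,
        ← Units.val_pow_eq_pow_val, hu, Units.val_one]
    · rw [hsplit, hz, ← mul_assoc]
      rw [eq_div_iff_mul_eq', Units.ext_iff] at hc
      simp only [Units.val_pow_eq_pow_val, Units.val_mk0, Units.val_mul] at hc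
      rw [← hc, mul_comm b]

theorem exists_mul_pow_eq_mul_pow_iff [CharP F 2] [Finite F] {M m : ℕ} (hF : Nat.card F = 2 ^ M)
    (hm : 0 < m) (hmM : m ∣ M) (a b : F) (i j : ℕ) {e : ℕ} (he : e = Int.gcd ((j : ℤ) - i) m) :
    (∃ z : F, z ≠ 0 ∧ z ^ 2 ^ m = z ∧ a * z ^ 2 ^ i = b * z ^ 2 ^ j) ↔
      a ^ ((2 ^ m - 1) / (2 ^ e - 1)) = b ^ ((2 ^ m - 1) / (2 ^ e - 1)) := by
  rcases le_total i j with h | h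
  · rw [← Nat.cast_sub h, Int.gcd_natCast_natCast] at he
    rw [he, exists_mul_pow_eq_mul_pow_iff_of_le hF hm hmM a b h]
  · rw [← neg_sub, Int.neg_gcd, ← Nat.cast_sub h, Int.gcd_natCast_natCast] at he
    rw [he, eq_comm, ← exists_mul_pow_eq_mul_pow_iff_of_le hF hm hmM b a h]
    simp only [eq_comm (a := a * _)]

theorem pow_two_pow_eq_self_of_natCard [Finite F] {M : ℕ} (hF : Nat.card F = 2 ^ M) (x : F) :
    x ^ 2 ^ M = x := by
  have := Fintype.ofFinite F
  rw [← hF, Nat.card_eq_fintype_card, FiniteField.pow_card]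

theorem pow_two_pow_eq_self_of_sq [CharP F 2] [Finite F] {m n : ℕ} (hF : Nat.card F = 2 ^ (m * n))
    (hn : Odd n) {y : F} (h : y ^ 2 ^ (m * 2) = y) : y ^ 2 ^ m = y := by
  have hy := pow_two_pow_eq_self_of_natCard hF y
  have := pow_two_pow_gcd_eq_self h hy
  rwa [Nat.gcd_mul_left, hn.coprime_two_left.gcd_eq_one, mul_one] at this

/-- The trace of an extension of degree `n` of the field with `2 ^ m` elements. -/
def relTrace {R : Type*} [CommRing R] (m n : ℕ) (x : R) : R :=
  ∑ i ∈ Finset.range n, x ^ (2 ^ m) ^ i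

theorem relTrace_add [CharP F 2] (m n : ℕ) (x y : F) :
    relTrace m n (x + y) = relTrace m n x + relTrace m n y := by
  simp only [relTrace, ← Finset.sum_add_distrib, ← pow_mul, add_pow_char_pow]

theorem relTrace_pow [Finite F] {m n : ℕ} (hF : Nat.card F = 2 ^ (m * n)) (x : F) :
    relTrace m n (x ^ 2 ^ m) = relTrace m n x := by
  have hx : x ^ (2 ^ m) ^ n = x := by
    rw [← pow_mul]
    exact pow_two_pow_eq_self_of_natCard hF x
  have h := Finset.sum_range_succ (fun i => x ^ (2 ^ m) ^ i) n
  rw [Finset.sum_range_succ', hx, pow_zero, pow_one] at h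
  rw [relTrace, relTrace, ← add_right_cancel h]
  exact Finset.sum_congr rfl fun i _ => by rw [← pow_mul, ← pow_succ']

theorem pow_relTrace [CharP F 2] [Finite F] {m n : ℕ} (hF : Nat.card F = 2 ^ (m * n)) (x : F) :
    relTrace m n x ^ 2 ^ m = relTrace m n x := by
  conv_rhs => rw [← relTrace_pow hF x]
  rw [relTrace, relTrace, sum_pow_char_pow]
  exact Finset.sum_congr rfl fun i _ => pow_right_comm _ _ _

theorem relTrace_of_fixed [CharP F 2] {m n : ℕ} (hn : Odd n) {c : F} (hc : c ^ 2 ^ m = c) :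
    relTrace m n c = c := by
  have h : ∀ i, c ^ (2 ^ m) ^ i = c := fun i => by
    rw [← pow_mul]
    exact pow_two_pow_eq_self_of_dvd hc (dvd_mul_right m i)
  obtain ⟨j, rfl⟩ := hn
  simp only [relTrace, h, Finset.sum_const, Finset.card_range, nsmul_eq_mul]
  push_cast
  rw [CharTwo.two_eq_zero, zero_mul, zero_add, one_mul]

theorem bijective_relTrace_add_iff [CharP F 2] [Finite F] {m n : ℕ}
    (hF : Nat.card F = 2 ^ (m * n)) (hn : Odd n) (L : F →+ F) :
    Function.Bijective (fun x => relTrace m n (x ^ (2 ^ m + 1)) + L x) ↔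
      (∀ y : F, y ≠ 0 → y ^ 2 ^ m = y → y ^ 2 + L y ≠ 0) ∧
        ∀ y : F, L y ^ 2 ^ m = L y → y ^ 2 ^ m = y := by
  have hexp : ∀ x y w : F, w ^ 2 ^ m = y →
      relTrace m n ((x + y) ^ (2 ^ m + 1)) + L (x + y) =
        relTrace m n (x ^ (2 ^ m + 1)) + L x + (relTrace m n (x * (y ^ 2 ^ m + w)) +
          (relTrace m n (y ^ (2 ^ m + 1)) + L y)) := by
    intro x y w hw
    have h1 : (x + y) ^ (2 ^ m + 1) =
        x ^ (2 ^ m + 1) + y ^ (2 ^ m + 1) + x * y ^ 2 ^ m + (x * w) ^ 2 ^ m := by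
      rw [mul_pow, hw, pow_succ, add_pow_char_pow]
      ring
    rw [h1, mul_add, map_add]
    simp only [relTrace_add, relTrace_pow hF]
    ring
  have hfix : ∀ y : F, y ^ 2 ^ m = y → relTrace m n (y ^ (2 ^ m + 1)) = y ^ 2 := by
    intro y hy
    rw [pow_succ, hy, ← sq, relTrace_of_fixed hn]
    rw [pow_right_comm, hy]
  have htr0 : relTrace m n (0 : F) = 0 := by
    have := relTrace_add m n (0 : F) 0
    simpa using this
  rw [← Finite.injective_iff_bijective]
  constructor
  · intro hinj
    have hne : ∀ x y w : F, w ^ 2 ^ m = y → y ≠ 0 →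
        relTrace m n (x * (y ^ 2 ^ m + w)) + (relTrace m n (y ^ (2 ^ m + 1)) + L y) ≠ 0 := by
      intro x y w hw hy h
      have := hexp x y w hw
      rw [h, add_zero] at this
      exact hy (by simpa using hinj this)
    refine ⟨fun y hy hym h => ?_, fun y hL => ?_⟩
    · refine hne 0 y y hym hy ?_
      rw [zero_mul, htr0, zero_add, hfix y hym, h]
    · by_contra hym
      obtain ⟨w, hw⟩ := pow_two_pow_surjective m y
      simp only at hw
      have hv : y ^ 2 ^ m + w ≠ 0 := by
        intro h0
        rw [CharTwo.add_eq_zero] at h0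
        refine hym (pow_two_pow_eq_self_of_sq hF hn ?_)
        rw [mul_two, pow_add, pow_mul, h0, hw]
      have hy : y ≠ 0 := by
        rintro rfl
        simp at hym
      refine hne ((relTrace m n (y ^ (2 ^ m + 1)) + L y) / (y ^ 2 ^ m + w)) y w hw hy ?_
      rw [div_mul_cancel₀ _ hv, relTrace_of_fixed hn, CharTwo.add_self_eq_zero]
      rw [add_pow_char_pow, pow_relTrace hF, hL]
  · rintro ⟨h1, h2⟩ x z hxz
    by_contra hne
    obtain ⟨y, rfl⟩ : ∃ y, z = x + y := ⟨z - x, by ring⟩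
    have hy : y ≠ 0 := by
      rintro rfl
      simp at hne
    obtain ⟨w, hw⟩ := pow_two_pow_surjective m y
    simp only at hw hxz
    rw [hexp x y w hw, left_eq_add] at hxz
    have hym : y ^ 2 ^ m = y := by
      apply h2
      rw [← add_assoc, CharTwo.add_eq_zero] at hxz
      rw [← hxz, add_pow_char_pow, pow_relTrace hF, pow_relTrace hF]
    have hwy : w = y := pow_two_pow_injective m (by simp only [hw, hym])
    refine h1 y hy hym ?_
    rwa [hwy, hym, CharTwo.add_self_eq_zero, mul_zero, htr0, zero_add, hfix y hym] at hxz

/-- The additive map `x ↦ a * x ^ 2 ^ k + b * x ^ 2 ^ l` in characteristic two. -/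
noncomputable def linearizedBinomial [CharP F 2] (a b : F) (k l : ℕ) : F →+ F :=
  (AddMonoidHom.mulLeft a).comp (iterateFrobenius F 2 k).toAddMonoidHom +
    (AddMonoidHom.mulLeft b).comp (iterateFrobenius F 2 l).toAddMonoidHom

theorem linearizedBinomial_apply [CharP F 2] (a b : F) (k l : ℕ) (x : F) :
    linearizedBinomial a b k l x = a * x ^ 2 ^ k + b * x ^ 2 ^ l := rfl

/-- A primitive element of the subfield with `2 ^ m` elements. -/
theorem exists_orderOf_eq_two_pow_sub_one [Finite F] {M m : ℕ} (hF : Nat.card F = 2 ^ M)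
    (hmM : m ∣ M) : ∃ t : F, t ≠ 0 ∧ orderOf t = 2 ^ m - 1 := by
  have hQ : 2 ^ m - 1 ∣ Nat.card Fˣ := by
    rw [Nat.card_units, hF]
    exact Nat.pow_sub_one_dvd_pow_sub_one 2 hmM
  obtain ⟨ζ, hζ⟩ := IsCyclic.exists_ofOrder_eq_natCard (α := Fˣ)
  obtain ⟨w, hw⟩ := hQ
  have hpos : 0 < Nat.card Fˣ := Nat.card_pos
  have hw0 : w ≠ 0 := by
    rintro rfl
    simp [hw] at hpos
  refine ⟨(ζ ^ w : Fˣ), Units.ne_zero _, ?_⟩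
  rw [orderOf_units, orderOf_pow_of_dvd hw0 (by rw [hζ, hw]; exact dvd_mul_left _ _), hζ, hw,
    Nat.mul_div_cancel _ (Nat.pos_of_ne_zero hw0)]

theorem dvd_of_forall_pow_two_pow_eq_self [Finite F] {M d m : ℕ} (hF : Nat.card F = 2 ^ M)
    (hdM : d ∣ M) (h : ∀ t : F, t ^ 2 ^ d = t → t ^ 2 ^ m = t) : d ∣ m := by
  obtain ⟨t, ht0, ht⟩ := exists_orderOf_eq_two_pow_sub_one hF hdM
  have h1 : t ^ 2 ^ m = t := by
    apply h
    rw [← pow_two_pow_sub_one_eq_one_iff ht0, ← ht, pow_orderOf_eq_one]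
  rw [← pow_two_pow_sub_one_eq_one_iff ht0] at h1
  have h2 := orderOf_dvd_of_pow_eq_one h1
  rw [ht] at h2
  have h3 := Nat.pow_sub_one_gcd_pow_sub_one 2 d m
  rw [Nat.gcd_eq_left h2] at h3
  have h4 : (2 : ℕ) ^ d = 2 ^ d.gcd m := by
    have := Nat.one_le_two_pow (n := d)
    have := Nat.one_le_two_pow (n := d.gcd m)
    omega
  rw [Nat.pow_right_injective le_rfl h4]
  exact Nat.gcd_dvd_right d m

theorem pow_two_pow_mod_of_fixed [CharP F 2] {m : ℕ} {y : F} (hy : y ^ 2 ^ m = y) (k : ℕ) :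
    y ^ 2 ^ (k % m) = y ^ 2 ^ k := by
  conv_rhs => rw [← Nat.div_add_mod k m, pow_add, pow_mul,
    pow_two_pow_eq_self_of_dvd hy (dvd_mul_right m _)]

theorem mod_eq_mod_of_forall_pow_eq [CharP F 2] [Finite F] {M m k l : ℕ} (hF : Nat.card F = 2 ^ M)
    (hm : 1 < m) (hmM : m ∣ M) (h : ∀ y : F, y ^ 2 ^ m = y → y ^ 2 ^ k = y ^ 2 ^ l) :
    k % m = l % m := by
  obtain ⟨t, ht0, ht⟩ := exists_orderOf_eq_two_pow_sub_one hF hmM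
  have htm : t ^ 2 ^ m = t := by
    rw [← pow_two_pow_sub_one_eq_one_iff ht0, ← ht, pow_orderOf_eq_one]
  have h1 := h t htm
  rw [← pow_two_pow_mod_of_fixed htm k, ← pow_two_pow_mod_of_fixed htm l] at h1
  have hlt : ∀ i, 2 ^ (i % m) < orderOf t := by
    intro i
    obtain ⟨r, rfl⟩ : ∃ r, m = r + 2 := ⟨m - 2, by omega⟩
    have h2 : 2 ^ (i % (r + 2)) ≤ 2 ^ (r + 1) :=
      Nat.pow_le_pow_right two_pos (by have := Nat.mod_lt i (show 0 < r + 2 by omega); omega)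
    have h3 := Nat.one_le_two_pow (n := r)
    rw [ht]
    rw [pow_succ] at h2
    rw [pow_add]
    omega
  exact Nat.pow_right_injective le_rfl (pow_injOn_Iio_orderOf (hlt k) (hlt l) h1)

theorem preimage_fixed_iff [CharP F 2] [Finite F] {m n k l : ℕ} (hF : Nat.card F = 2 ^ (m * n))
    (hn : Odd n) (hm : 1 < m) (hkl : k % m ≠ l % m) (a b : F) :
    (∀ y, linearizedBinomial a b k l y ^ 2 ^ m = linearizedBinomial a b k l y → y ^ 2 ^ m = y) ↔
      a ^ 2 ^ m = a ∧ b ^ 2 ^ m = b ∧ ∀ z, linearizedBinomial a b k l z = 0 → z ^ 2 ^ m = z := by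
  have hpow : ∀ z, linearizedBinomial a b k l z ^ 2 ^ m =
      a ^ 2 ^ m * (z ^ 2 ^ m) ^ 2 ^ k + b ^ 2 ^ m * (z ^ 2 ^ m) ^ 2 ^ l := by
    intro z
    rw [linearizedBinomial_apply, add_pow_char_pow, mul_pow, mul_pow, pow_right_comm z (2 ^ k),
      pow_right_comm z (2 ^ l)]
  constructor
  · intro h
    let T : F →+ F := (iterateFrobenius F 2 m).toAddMonoidHom - AddMonoidHom.id F
    have hT : ∀ x, x ∈ T.ker ↔ x ^ 2 ^ m = x := fun x => sub_eq_zero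
    have hker := AddMonoidHom.ker_comp_eq_of_le T (linearizedBinomial a b k l)
      fun y hy => (hT y).mpr (h y ((hT _).mp hy))
    have hL : ∀ y, y ^ 2 ^ m = y → a ^ 2 ^ m * y ^ 2 ^ k + b ^ 2 ^ m * y ^ 2 ^ l =
        a * y ^ 2 ^ k + b * y ^ 2 ^ l := by
      intro y hy
      have := (hT _).mp (hker.ge ((hT y).mpr hy))
      rwa [hpow, hy] at this
    have hA : ∀ y : F, y ^ 2 ^ m = y →
        (a ^ 2 ^ m - a) * y ^ 2 ^ k = (a ^ 2 ^ m - a) * y ^ 2 ^ l := by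
      intro y hy
      have h1 := hL 1 (one_pow _)
      simp only [one_pow, mul_one] at h1
      linear_combination hL y hy - y ^ 2 ^ l * h1
    have ha : a ^ 2 ^ m = a := by
      by_contra hne
      exact hkl (mod_eq_mod_of_forall_pow_eq hF hm (dvd_mul_right m n) fun y hy =>
        mul_left_cancel₀ (sub_ne_zero.mpr hne) (hA y hy))
    refine ⟨ha, ?_, fun z hz => h z (by rw [hz, zero_pow (by positivity)])⟩
    have h1 := hL 1 (one_pow _)
    simpa [ha] using h1
  · rintro ⟨ha, hb, h⟩ y hy
    have hz : (y ^ 2 ^ m + y) ^ 2 ^ m = y ^ 2 ^ m + y := by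
      apply h
      rw [map_add, CharTwo.add_eq_zero, ← hy, hpow, ha, hb, linearizedBinomial_apply]
    refine pow_two_pow_eq_self_of_sq hF hn ?_
    rw [add_pow_char_pow, add_comm, add_right_inj] at hz
    rw [mul_two, pow_add, pow_mul, hz]

theorem pow_two_pow_eq_pow_two_pow_iff [CharP F 2] {M k l : ℕ} {t : F} (ht : t ^ 2 ^ M = t) :
    t ^ 2 ^ k = t ^ 2 ^ l ↔ t ^ 2 ^ Int.gcd ((l : ℤ) - k) M = t := by
  wlog hkl : k ≤ l generalizing k l
  · rw [eq_comm, this (le_of_not_ge hkl), ← neg_sub, Int.neg_gcd]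
  rw [← Nat.cast_sub hkl, Int.gcd_natCast_natCast]
  obtain ⟨r, rfl⟩ := Nat.exists_eq_add_of_le hkl
  rw [Nat.add_sub_cancel_left, add_comm, pow_add, pow_mul]
  constructor
  · exact fun h => pow_two_pow_gcd_eq_self (pow_two_pow_injective k h).symm ht
  · exact fun h => by rw [pow_two_pow_eq_self_of_dvd h (Nat.gcd_dvd_left r M)]

theorem ker_fixed_iff [CharP F 2] [Finite F] {m n k l d : ℕ} (hF : Nat.card F = 2 ^ (m * n))
    (hm : 0 < m) (hn : 0 < n) {a b : F} (hab : ¬(a = 0 ∧ b = 0))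
    (hd : d = Int.gcd ((l : ℤ) - k) ((m : ℤ) * n)) :
    (∀ z, linearizedBinomial a b k l z = 0 → z ^ 2 ^ m = z) ↔
      (a ^ ((2 ^ (m * n) - 1) / (2 ^ d - 1)) ≠ b ^ ((2 ^ (m * n) - 1) / (2 ^ d - 1)) ∨
        (d ∣ m ∧ a ^ ((2 ^ m - 1) / (2 ^ d - 1)) = b ^ ((2 ^ m - 1) / (2 ^ d - 1)))) := by
  have hmn : 0 < m * n := Nat.mul_pos hm hn
  have hall : ∀ z : F, z ^ 2 ^ (m * n) = z :=
    pow_two_pow_eq_self_of_natCard hF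
  have hker : ∀ z, linearizedBinomial a b k l z = 0 ↔ a * z ^ 2 ^ k = b * z ^ 2 ^ l := fun z =>
    CharTwo.add_eq_zero
  have hdM : d ∣ m * n := by
    rw [hd]
    exact_mod_cast Int.gcd_dvd_right ((l : ℤ) - k) ((m : ℤ) * n)
  have hd0 : 0 < d := Nat.pos_of_dvd_of_pos hdM hmn
  have hfull := exists_mul_pow_eq_mul_pow_iff hF hmn dvd_rfl a b k l (e := d)
    (by rw [hd, Nat.cast_mul])
  have hsub : d ∣ m → d = Int.gcd ((l : ℤ) - k) m := by
    intro hdm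
    apply Nat.dvd_antisymm
    · refine Int.dvd_gcd ?_ (by exact_mod_cast hdm)
      rw [hd]
      exact Int.gcd_dvd_left _ _
    · rw [hd]
      exact Int.gcd_dvd_gcd_of_dvd_right _ (dvd_mul_right _ _)
  have hE := two_pow_sub_one_div_ne_zero hmn hdM
  simp only [hker]
  by_cases heq : a ^ ((2 ^ (m * n) - 1) / (2 ^ d - 1)) = b ^ ((2 ^ (m * n) - 1) / (2 ^ d - 1))
  · have ha : a ≠ 0 := by
      rintro rfl
      rw [zero_pow hE, eq_comm, pow_eq_zero_iff hE] at heq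
      exact hab ⟨rfl, heq⟩
    have hquot : ∀ z w : F, w ≠ 0 → a * w ^ 2 ^ k = b * w ^ 2 ^ l →
        (a * z ^ 2 ^ k = b * z ^ 2 ^ l ↔ (z / w) ^ 2 ^ d = z / w) := by
      intro z w hw h
      rw [hd, ← Nat.cast_mul, ← pow_two_pow_eq_pow_two_pow_iff (hall _), div_pow, div_pow,
        div_eq_div_iff (pow_ne_zero _ hw) (pow_ne_zero _ hw)]
      have hb : b ≠ 0 := by
        rintro rfl
        simp [ha, hw] at h
      constructor
      · intro h1
        apply mul_left_cancel₀ (mul_ne_zero ha hb)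
        linear_combination b * w ^ 2 ^ l * h1 - b * z ^ 2 ^ l * h
      · intro h1
        apply mul_left_cancel₀ (pow_ne_zero (2 ^ l) hw)
        linear_combination a * h1 + z ^ 2 ^ l * h
    simp only [heq, ne_eq, not_true_eq_false, false_or]
    constructor
    · intro hfix
      obtain ⟨w, hw, -, h⟩ := hfull.mpr heq
      have hdm : d ∣ m := by
        refine dvd_of_forall_pow_two_pow_eq_self hF hdM fun t ht => ?_
        have h1 := hfix (t * w) ((hquot _ w hw h).mpr (by rwa [mul_div_cancel_right₀ _ hw]))
        rw [mul_pow, hfix w h] at h1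
        exact mul_right_cancel₀ hw h1
      exact ⟨hdm, (exists_mul_pow_eq_mul_pow_iff hF hm (dvd_mul_right m n) a b k l
        (hsub hdm)).mp ⟨w, hw, hfix w h, h⟩⟩
    · rintro ⟨hdm, hpow⟩ z hz
      obtain ⟨w, hw, hwm, h⟩ := (exists_mul_pow_eq_mul_pow_iff hF hm (dvd_mul_right m n) a b k l
        (hsub hdm)).mpr hpow
      have h1 := pow_two_pow_eq_self_of_dvd ((hquot z w hw h).mp hz) hdm
      rwa [div_pow, hwm, div_left_inj' hw] at h1
  · simp only [heq, ne_eq, not_false_eq_true, true_or, iff_true]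
    intro z hz
    by_contra hzm
    refine heq (hfull.mp ⟨z, ?_, hall z, hz⟩)
    rintro rfl
    simp at hzm

end FiniteField

/-- Let `n` be odd, `q = 2^m`, `F` the field with `q^n` elements,
`L(x) = a·x^(2^k) + b·x^(2^l)` nonzero with `0 ≤ k, l < mn`, `k ≢ l (mod m)` and
`l ≡ 1 (mod m)`.  With `d = gcd(l-k, mn)` and `s = gcd(k-1, m)`, `Tr(x^(q+1)) + L(x)` is a
permutation polynomial of `F` iff `a, b ∈ F_q`, `a^((q-1)/(2^s-1)) ≠ (b+1)^((q-1)/(2^s-1))`,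
and either `a^((q^n-1)/(2^d-1)) ≠ b^((q^n-1)/(2^d-1))` or (`d ∣ m` and
`a^((q-1)/(2^d-1)) = b^((q-1)/(2^d-1))`).  In particular, when `b = 0` it is a permutation
polynomial iff `a ∈ F_q^*` and `a^((q-1)/(2^s-1)) ≠ 1`. -/
theorem stmt_3 (m n : ℕ) (hm : 0 < m) (hn : Odd n)
    (F : Type*) [Field F] [Fintype F] (hF : Fintype.card F = 2 ^ (m * n))
    (a b : F) (k l : ℕ) (hk : k < m * n) (hl : l < m * n)
    (hab : ¬(a = 0 ∧ b = 0)) (hkl : k % m ≠ l % m) (hl1 : l % m = 1 % m)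
    (d s : ℕ)
    (hd : d = Int.gcd ((l : ℤ) - (k : ℤ)) ((m : ℤ) * (n : ℤ)))
    (hs : s = Int.gcd ((k : ℤ) - 1) (m : ℤ))
    (Tr : F → F)
    (hTr : ∀ x, Tr x = ∑ i ∈ Finset.range n, x ^ (2 ^ m) ^ i) :
    (Function.Bijective (fun x : F => Tr (x ^ (2 ^ m + 1)) + (a * x ^ 2 ^ k + b * x ^ 2 ^ l)) ↔
      (a ^ 2 ^ m = a ∧ b ^ 2 ^ m = b ∧
        a ^ ((2 ^ m - 1) / (2 ^ s - 1)) ≠ (b + 1) ^ ((2 ^ m - 1) / (2 ^ s - 1)) ∧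
        (a ^ ((2 ^ (m * n) - 1) / (2 ^ d - 1)) ≠ b ^ ((2 ^ (m * n) - 1) / (2 ^ d - 1)) ∨
          (d ∣ m ∧ a ^ ((2 ^ m - 1) / (2 ^ d - 1)) = b ^ ((2 ^ m - 1) / (2 ^ d - 1)))))) ∧
    (b = 0 →
      (Function.Bijective (fun x : F => Tr (x ^ (2 ^ m + 1)) + a * x ^ 2 ^ k) ↔
        (a ≠ 0 ∧ a ^ 2 ^ m = a ∧ a ^ ((2 ^ m - 1) / (2 ^ s - 1)) ≠ 1))) := by
  have := charP_of_card_eq_prime_pow hF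
  rw [← Nat.card_eq_fintype_card] at hF
  have hm1 : 1 < m := by
    by_contra h
    obtain rfl : m = 1 := by omega
    exact hkl (by rw [Nat.mod_one, Nat.mod_one])
  refine (and_iff_left_of_imp fun hmain => ?_).mpr ?_
  · rintro rfl
    have ha : a ≠ 0 := fun h => hab ⟨h, rfl⟩
    have hdmn : d ∣ m * n := by
      rw [hd]
      exact_mod_cast Int.gcd_dvd_right ((l : ℤ) - k) ((m : ℤ) * n)
    have hE := two_pow_sub_one_div_ne_zero (Nat.mul_pos hm hn.pos) hdmn
    simpa [ha, hE] using hmain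
  · obtain rfl : Tr = relTrace m n := funext hTr
    have hsol := exists_mul_pow_eq_mul_pow_iff hF hm (dvd_mul_right m n) (b + 1) a 1 k
      (e := s) (by exact_mod_cast hs)
    have hsub : (∀ y : F, y ≠ 0 → y ^ 2 ^ m = y → y ^ 2 + linearizedBinomial a b k l y ≠ 0) ↔
        a ^ ((2 ^ m - 1) / (2 ^ s - 1)) ≠ (b + 1) ^ ((2 ^ m - 1) / (2 ^ s - 1)) := by
      rw [ne_comm, ne_eq, ← hsol]
      push Not
      refine forall₃_congr fun y _ hym => not_congr ?_
      rw [linearizedBinomial_apply, ← pow_two_pow_mod_of_fixed hym l, hl1,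
        pow_two_pow_mod_of_fixed hym, pow_one,
        ← CharTwo.add_eq_zero (a := (b + 1) * _)]
      ring_nf
    rw [← ker_fixed_iff hF hm hn.pos hab hd, ← hsub]
    refine (bijective_relTrace_add_iff hF hn (linearizedBinomial a b k l)).trans ?_
    rw [preimage_fixed_iff hF hn hm1 hkl]
    tauto
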